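/- Let H_1 and H_2 be positive semidefinite d×d complex matrices, let φ_1, φ_2 be real numbers, let X_1 and X_2 be arbitrary m×m' complex matrices, and let p ≥ 1. Then ‖e^{iφ_1} H_1 ⊗ X_1 + e^{iφ_2} H_2 ⊗ X_2‖_p ≤ max_{θ∈[0,2π)} ‖ ‖X_1‖_p · H_1 + e^{iθ} ‖X_2‖_p · H_2 ‖_p. -/

import Mathlib

open scoped Kronecker ComplexOrder
open Matrix

/-- The Schatten `q`-norm of a complex matrix `A`, i.e. `(Tr((A† A)^{q/2}))^{1/q}`,
computed via the eigenvalues of `Aᴴ * A` (the squares of the singular values of `A`). -/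
noncomputable def schattenNorm {m n : Type*} [Fintype m] [Fintype n] [DecidableEq n]
    (q : ℝ) (A : Matrix m n ℂ) : ℝ :=
  (∑ i, (Matrix.posSemidef_conjTranspose_mul_self A).1.eigenvalues i ^ (q / 2)) ^ (1 / q)

open scoped Matrix.Norms.L2Operator

/-- The real power `a ^ w` with complex exponent, set to `0` at `a = 0` for every `w`, so that it is
entire in `w`. -/
noncomputable def zeroCpow (a : ℝ) (w : ℂ) : ℂ :=
  if a = 0 then 0 else Complex.exp (w * Real.log a)

theorem norm_zeroCpow_le {a : ℝ} (ha : 0 ≤ a) (w : ℂ) : ‖zeroCpow a w‖ ≤ a ^ w.re := by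
  unfold zeroCpow
  split_ifs with h
  · simpa using Real.rpow_nonneg ha _
  · have : 0 < a := lt_of_le_of_ne ha (Ne.symm h)
    rw [Complex.norm_exp, Complex.re_mul_ofReal, Real.rpow_def_of_pos this, mul_comm]

theorem zeroCpow_ofReal {a r : ℝ} (ha : 0 ≤ a) (hr : r ≠ 0) :
    zeroCpow a r = ((a ^ r : ℝ) : ℂ) := by
  unfold zeroCpow
  split_ifs with h
  · simp [h, Real.zero_rpow hr]
  · have : 0 < a := lt_of_le_of_ne ha (Ne.symm h)
    rw [Real.rpow_def_of_pos this, Complex.ofReal_exp, mul_comm]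
    push_cast; rfl

theorem zeroCpow_add (a : ℝ) (w z : ℂ) : zeroCpow a (w + z) = zeroCpow a w * zeroCpow a z := by
  unfold zeroCpow
  split_ifs with h
  · simp
  · rw [add_mul, Complex.exp_add]

/-- Entire functions that are bounded on the closed strip `0 ≤ re z ≤ 1`. -/
def BoundedEntire (f : ℂ → ℂ) : Prop :=
  Differentiable ℂ f ∧ ∃ C, ∀ z : ℂ, 0 ≤ z.re → z.re ≤ 1 → ‖f z‖ ≤ C

theorem BoundedEntire.const (c : ℂ) : BoundedEntire fun _ => c :=
  ⟨differentiable_const c, ‖c‖, fun _ _ _ => le_rfl⟩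

theorem BoundedEntire.add {f g : ℂ → ℂ} (hf : BoundedEntire f) (hg : BoundedEntire g) :
    BoundedEntire fun z => f z + g z := by
  obtain ⟨hf, C, hC⟩ := hf
  obtain ⟨hg, D, hD⟩ := hg
  exact ⟨hf.add hg, C + D, fun z h0 h1 =>
    (norm_add_le _ _).trans (add_le_add (hC z h0 h1) (hD z h0 h1))⟩

theorem BoundedEntire.mul {f g : ℂ → ℂ} (hf : BoundedEntire f) (hg : BoundedEntire g) :
    BoundedEntire fun z => f z * g z := by
  obtain ⟨hf, C, hC⟩ := hf
  obtain ⟨hg, D, hD⟩ := hg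
  refine ⟨hf.mul hg, C * D, fun z h0 h1 => ?_⟩
  rw [norm_mul]
  exact mul_le_mul (hC z h0 h1) (hD z h0 h1) (norm_nonneg _)
    ((norm_nonneg _).trans (hC z h0 h1))

theorem BoundedEntire.sum {ι : Type*} (s : Finset ι) {f : ι → ℂ → ℂ}
    (hf : ∀ i, BoundedEntire (f i)) : BoundedEntire fun z => ∑ i ∈ s, f i z := by
  classical
  induction s using Finset.induction_on with
  | empty => simpa using BoundedEntire.const 0
  | insert i s hi ih => simpa [Finset.sum_insert hi] using (hf i).add ih

theorem boundedEntire_zeroCpow (a b c : ℝ) :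
    BoundedEntire fun z => zeroCpow a (b * z + c) := by
  unfold zeroCpow
  split_ifs with h
  · exact .const 0
  · refine ⟨by fun_prop, Real.exp ((|b| + |c|) * |Real.log a|), fun z h0 h1 => ?_⟩
    rw [Complex.norm_exp, Real.exp_le_exp, Complex.re_mul_ofReal]
    refine (le_abs_self _).trans ?_
    rw [abs_mul]
    refine mul_le_mul_of_nonneg_right ?_ (abs_nonneg _)
    simp only [Complex.add_re, Complex.re_ofReal_mul, Complex.ofReal_re]
    refine (abs_add_le _ _).trans (add_le_add_left ?_ _)
    rw [abs_mul, abs_of_nonneg h0]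
    exact mul_le_of_le_one_right (abs_nonneg _) h1

theorem boundedEntire_zeroCpow_mul (a b : ℝ) : BoundedEntire fun z => zeroCpow a (b * z) := by
  simpa using boundedEntire_zeroCpow a b 0

/-- Matrix-valued functions all of whose entries are entire and bounded on the strip. -/
def MatrixBoundedEntire {m n : Type*} (F : ℂ → Matrix m n ℂ) : Prop :=
  ∀ i j, BoundedEntire fun z => F z i j

section

variable {l m n k : Type*}

theorem MatrixBoundedEntire.const (A : Matrix m n ℂ) : MatrixBoundedEntire fun _ => A :=
  fun _ _ => .const _

theorem MatrixBoundedEntire.add {F G : ℂ → Matrix m n ℂ} (hF : MatrixBoundedEntire F)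
    (hG : MatrixBoundedEntire G) : MatrixBoundedEntire fun z => F z + G z :=
  fun i j => (hF i j).add (hG i j)

theorem MatrixBoundedEntire.mul [Fintype n] {F : ℂ → Matrix m n ℂ} {G : ℂ → Matrix n l ℂ}
    (hF : MatrixBoundedEntire F) (hG : MatrixBoundedEntire G) :
    MatrixBoundedEntire fun z => F z * G z :=
  fun i j => by
    simp only [Matrix.mul_apply]
    exact .sum _ fun a => (hF i a).mul (hG a j)

theorem MatrixBoundedEntire.kronecker {F : ℂ → Matrix m n ℂ} {G : ℂ → Matrix l k ℂ}
    (hF : MatrixBoundedEntire F) (hG : MatrixBoundedEntire G) :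
    MatrixBoundedEntire fun z => F z ⊗ₖ G z :=
  fun _ _ => (hF _ _).mul (hG _ _)

theorem MatrixBoundedEntire.diagonal [DecidableEq n] {f : n → ℂ → ℂ}
    (hf : ∀ i, BoundedEntire (f i)) :
    MatrixBoundedEntire fun z => Matrix.diagonal fun i => f i z := by
  intro i j
  by_cases h : i = j
  · subst h
    simpa using hf i
  · simpa [Matrix.diagonal_apply_ne _ h] using BoundedEntire.const 0

theorem MatrixBoundedEntire.trace [Fintype n] {F : ℂ → Matrix n n ℂ}
    (hF : MatrixBoundedEntire F) : BoundedEntire fun z => (F z).trace :=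
  .sum _ fun i => hF i i

theorem BoundedEntire.norm_le_interp {f : ℂ → ℂ} (hf : BoundedEntire f) {a b : ℝ}
    (ha : ∀ z : ℂ, z.re = 0 → ‖f z‖ ≤ a) (hb : ∀ z : ℂ, z.re = 1 → ‖f z‖ ≤ b)
    {t : ℝ} (h0 : 0 ≤ t) (h1 : t ≤ 1) : ‖f t‖ ≤ a ^ (1 - t) * b ^ t := by
  obtain ⟨hd, C, hC⟩ := hf
  have := Complex.HadamardThreeLines.norm_le_interp_of_mem_verticalClosedStrip' (f := f)
    (z := (t : ℂ)) (a := a) (b := b) (l := 0) (u := 1) one_pos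
    ⟨by simpa using h0, by simpa using h1⟩
    hd.diffContOnCl ⟨C, by rintro _ ⟨z, hz, rfl⟩; exact hC z hz.1 hz.2⟩
    (fun z hz => ha z hz) (fun z hz => hb z hz)
  simpa using this

end

section

variable {l m n k : Type*} [Fintype l] [Fintype m] [Fintype n] [Fintype k]
  [DecidableEq l] [DecidableEq m] [DecidableEq n] [DecidableEq k]

omit [DecidableEq m] in
theorem norm_matrix_mul_le_one {A : Matrix m n ℂ} {B : Matrix n l ℂ} (hA : ‖A‖ ≤ 1) (hB : ‖B‖ ≤ 1) :
    ‖A * B‖ ≤ 1 :=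
  (Matrix.l2_opNorm_mul A B).trans (mul_le_one₀ hA (norm_nonneg _) hB)

theorem norm_diagonal_le_one {c : n → ℂ} (hc : ∀ i, ‖c i‖ ≤ 1) : ‖Matrix.diagonal c‖ ≤ 1 := by
  rw [Matrix.l2_opNorm_diagonal]
  exact (pi_norm_le_iff_of_nonneg zero_le_one).2 hc

omit [DecidableEq m] in
theorem norm_matrix_le_one_iff {A : Matrix m n ℂ} : ‖A‖ ≤ 1 ↔ ‖Aᴴ * A‖ ≤ 1 := by
  rw [Matrix.l2_opNorm_conjTranspose_mul_self, ← sq]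
  exact (sq_le_one_iff₀ (norm_nonneg _)).symm

omit [DecidableEq m] in
theorem norm_matrix_apply_le (A : Matrix m n ℂ) (i : m) (j : n) : ‖A i j‖ ≤ ‖A‖ := by
  have h := Matrix.l2_opNorm_mulVec A (EuclideanSpace.single j 1)
  simp only [PiLp.norm_single, norm_one, mul_one] at h
  refine le_trans ?_ h
  refine le_trans (le_of_eq ?_) (PiLp.norm_apply_le _ i)
  simp

theorem norm_trace_diagonal_mul_le (c : n → ℂ) (B : Matrix n n ℂ) (hB : ‖B‖ ≤ 1) :
    ‖(Matrix.diagonal c * B).trace‖ ≤ ∑ i, ‖c i‖ := by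
  refine (norm_sum_le _ _).trans (Finset.sum_le_sum fun i _ => ?_)
  rw [Matrix.diag_apply, Matrix.diagonal_mul, norm_mul]
  exact mul_le_of_le_one_right (norm_nonneg _) ((norm_matrix_apply_le B i i).trans hB)

theorem norm_kronecker_one_le (A : Matrix n n ℂ) : ‖A ⊗ₖ (1 : Matrix m m ℂ)‖ ≤ ‖A‖ := by
  let φ : Matrix n n ℂ →⋆ₙₐ[ℂ] Matrix (n × m) (n × m) ℂ :=
    { toFun := fun A => A ⊗ₖ (1 : Matrix m m ℂ)
      map_smul' := fun c A => by simp [Matrix.smul_kronecker]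
      map_zero' := Matrix.zero_kronecker _
      map_add' := fun A B => Matrix.add_kronecker _ _ _
      map_mul' := fun A B => by rw [← Matrix.mul_kronecker_mul, one_mul]
      map_star' := fun A => by
        simp [Matrix.star_eq_conjTranspose, Matrix.conjTranspose_kronecker] }
  exact NonUnitalStarAlgHom.norm_apply_le φ A

theorem norm_one_kronecker_le (A : Matrix n n ℂ) : ‖(1 : Matrix m m ℂ) ⊗ₖ A‖ ≤ ‖A‖ := by
  let φ : Matrix n n ℂ →⋆ₙₐ[ℂ] Matrix (m × n) (m × n) ℂ :=
    { toFun := fun A => (1 : Matrix m m ℂ) ⊗ₖ A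
      map_smul' := fun c A => by simp [Matrix.kronecker_smul]
      map_zero' := Matrix.kronecker_zero _
      map_add' := fun A B => Matrix.kronecker_add _ _ _
      map_mul' := fun A B => by rw [← Matrix.mul_kronecker_mul, one_mul]
      map_star' := fun A => by
        simp [Matrix.star_eq_conjTranspose, Matrix.conjTranspose_kronecker] }
  exact NonUnitalStarAlgHom.norm_apply_le φ A

omit [DecidableEq l] [DecidableEq m] in
theorem norm_kronecker_le_one {A : Matrix m n ℂ} {B : Matrix l k ℂ} (hA : ‖A‖ ≤ 1) (hB : ‖B‖ ≤ 1) :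
    ‖A ⊗ₖ B‖ ≤ 1 := by
  rw [norm_matrix_le_one_iff] at hA hB ⊢
  rw [Matrix.conjTranspose_kronecker, ← Matrix.mul_kronecker_mul,
    show (Aᴴ * A) ⊗ₖ (Bᴴ * B) = ((Aᴴ * A) ⊗ₖ 1) * (1 ⊗ₖ (Bᴴ * B)) by
      rw [← Matrix.mul_kronecker_mul, one_mul, mul_one]]
  exact norm_matrix_mul_le_one ((norm_kronecker_one_le _).trans hA)
    ((norm_one_kronecker_le _).trans hB)

theorem norm_conjTranspose_le_one {A : Matrix m n ℂ} (hA : ‖A‖ ≤ 1) : ‖Aᴴ‖ ≤ 1 := by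
  rwa [Matrix.l2_opNorm_conjTranspose]

omit [DecidableEq m] in
/-- Singular value decomposition. -/
theorem exists_svd (A : Matrix m n ℂ) :
    ∃ (U : Matrix m n ℂ) (V : Matrix n n ℂ), ‖U‖ ≤ 1 ∧ ‖V‖ ≤ 1 ∧
      A = U * Matrix.diagonal (fun i =>
        ((√((Matrix.posSemidef_conjTranspose_mul_self A).1.eigenvalues i) : ℝ) : ℂ)) * Vᴴ ∧
      Uᴴ * A * V = Matrix.diagonal (fun i =>
        ((√((Matrix.posSemidef_conjTranspose_mul_self A).1.eigenvalues i) : ℝ) : ℂ)) := by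
  set hA := (Matrix.posSemidef_conjTranspose_mul_self A) with hAdef
  set e := hA.1.eigenvalues with he
  have he0 : ∀ i, 0 ≤ e i := hA.eigenvalues_nonneg
  set V : Matrix n n ℂ := (hA.1.eigenvectorUnitary : Matrix n n ℂ) with hV
  have hV1 : Vᴴ * V = 1 := Matrix.mem_unitaryGroup_iff'.1 hA.1.eigenvectorUnitary.2
  have hV2 : V * Vᴴ = 1 := Matrix.mem_unitaryGroup_iff.1 hA.1.eigenvectorUnitary.2
  have hsp : Aᴴ * A = V * Matrix.diagonal (fun i => ((e i : ℝ) : ℂ)) * Vᴴ := by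
    have := hA.1.spectral_theorem
    rw [Unitary.conjStarAlgAut_apply] at this
    exact this
  set σ : n → ℝ := fun i => √(e i) with hσ
  have hσe : ∀ i, σ i * σ i = e i := fun i => Real.mul_self_sqrt (he0 i)
  set D : Matrix n n ℂ := Matrix.diagonal (fun i => ((σ i : ℝ) : ℂ)) with hD
  set J : Matrix n n ℂ := Matrix.diagonal (fun i => (((σ i)⁻¹ : ℝ) : ℂ)) with hJ
  have hJH : Jᴴ = J := by
    rw [hJ, Matrix.diagonal_conjTranspose]
    congr 1
    ext i
    simp
  have hVAV : Vᴴ * (Aᴴ * A) * V = D * D := by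
    rw [hsp]
    calc _ = (Vᴴ * V) * Matrix.diagonal (fun i => ((e i : ℝ) : ℂ)) * (Vᴴ * V) := by
          simp only [Matrix.mul_assoc]
      _ = _ := by
          rw [hV1, one_mul, mul_one, hD, Matrix.diagonal_mul_diagonal]
          congr 1
          ext i
          rw [← hσe i]
          push_cast
          rfl
  have hVn : ‖V‖ ≤ 1 := by
    rw [norm_matrix_le_one_iff, hV1, ← Matrix.diagonal_one]
    exact norm_diagonal_le_one (by simp)
  have hAVJD : A * V * J * D = A * V := by
    set P : Matrix n n ℂ := 1 - J * D with hP
    have hPz : D * P = 0 := by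
      rw [hP, mul_sub, mul_one, hD, hJ, Matrix.diagonal_mul_diagonal, Matrix.diagonal_mul_diagonal,
        Matrix.diagonal_sub, ← Matrix.diagonal_zero]
      congr 1
      ext i
      by_cases h : σ i = 0
      · simp [h]
      · have : (σ i : ℂ) ≠ 0 := by exact_mod_cast h
        simp [this]
    have : (A * V * P)ᴴ * (A * V * P) = 0 := by
      calc _ = Pᴴ * (Vᴴ * (Aᴴ * A) * V) * P := by
            simp only [Matrix.conjTranspose_mul, Matrix.mul_assoc]
        _ = Pᴴ * D * (D * P) := by rw [hVAV]; simp only [Matrix.mul_assoc]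
        _ = 0 := by rw [hPz, mul_zero]
    rw [Matrix.conjTranspose_mul_self_eq_zero, hP, Matrix.mul_sub, Matrix.mul_one,
      sub_eq_zero] at this
    rw [Matrix.mul_assoc _ J D, ← this]
  refine ⟨A * V * J, V, ?_, hVn, ?_, ?_⟩
  · rw [norm_matrix_le_one_iff]
    have : (A * V * J)ᴴ * (A * V * J) = J * (D * D) * J := by
      rw [← hVAV]
      simp only [Matrix.conjTranspose_mul, Matrix.mul_assoc, hJH]
    rw [this, hD, hJ, Matrix.diagonal_mul_diagonal, Matrix.diagonal_mul_diagonal,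
      Matrix.diagonal_mul_diagonal]
    refine norm_diagonal_le_one fun i => ?_
    by_cases h : σ i = 0
    · simp [h]
    · have : (σ i : ℂ) ≠ 0 := by exact_mod_cast h
      simp [this]
  · rw [hAVJD, Matrix.mul_assoc, hV2, Matrix.mul_one]
  · have : (A * V * J)ᴴ * A * V = J * (Vᴴ * (Aᴴ * A) * V) := by
      simp only [Matrix.conjTranspose_mul, Matrix.mul_assoc, hJH]
    rw [this, hVAV, hD, hJ, Matrix.diagonal_mul_diagonal, Matrix.diagonal_mul_diagonal]
    congr 1
    ext i
    by_cases h : σ i = 0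
    · simp [h]
    · have : (σ i : ℂ) ≠ 0 := by exact_mod_cast h
      rw [Complex.ofReal_inv, inv_mul_cancel_left₀ this]

omit [DecidableEq m] in
/-- The Schatten norm of a positive semidefinite `Kᴴ * K` through its own eigenvalues. -/
theorem schattenNorm_conjTranspose_mul_self (q : ℝ) (K : Matrix m n ℂ) :
    schattenNorm q (Kᴴ * K) =
      (∑ i, (Matrix.posSemidef_conjTranspose_mul_self K).1.eigenvalues i ^ q) ^ (1 / q) := by
  unfold schattenNorm
  congr 1
  set hS := Matrix.posSemidef_conjTranspose_mul_self K
  set hS2 := Matrix.posSemidef_conjTranspose_mul_self (Kᴴ * K)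
  have h1 : (Kᴴ * K)ᴴ * (Kᴴ * K) = cfc (fun x : ℝ => x ^ 2) (Kᴴ * K) := by
    rw [cfc_pow_id (R := ℝ) (Kᴴ * K) 2 hS.1.isSelfAdjoint, hS.1.eq, sq]
  have h2 := congrArg (fun M : Matrix n n ℂ => (M.charpoly.roots.map
    fun c : ℂ => c.re ^ (q / 2)).sum) h1
  have h3 : (cfc (fun x : ℝ => x ^ 2) (Kᴴ * K)).charpoly.roots =
      Multiset.map (fun i => ((hS.1.eigenvalues i ^ 2 : ℝ) : ℂ)) Finset.univ.val := by
    rw [hS.1.charpoly_cfc_eq, Polynomial.roots_prod _ _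
      (Finset.prod_ne_zero_iff.2 fun i _ => Polynomial.X_sub_C_ne_zero _)]
    simp only [Polynomial.roots_X_sub_C, Multiset.bind_singleton]
    rfl
  simp only [hS2.1.roots_charpoly_eq_eigenvalues, h3, Multiset.map_map] at h2
  have h4 : ∑ i, hS2.1.eigenvalues i ^ (q / 2) = ∑ i, (hS.1.eigenvalues i ^ 2) ^ (q / 2) := by
    simpa [Finset.sum, -Finset.sum_map_val, -Complex.ofReal_pow] using h2
  rw [h4]
  refine Finset.sum_congr rfl fun i _ => ?_
  rw [← Real.rpow_natCast, ← Real.rpow_mul (hS.eigenvalues_nonneg i)]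
  congr 1
  push_cast
  ring

end

section

variable {a b d m n : Type*} [Fintype a] [Fintype b] [Fintype d] [Fintype m] [Fintype n]
  [DecidableEq a] [DecidableEq b] [DecidableEq d] [DecidableEq m] [DecidableEq n]

omit [DecidableEq a] [DecidableEq m] in
theorem norm_fromBlocks_diagonal_le_one {A : Matrix a b ℂ} {B : Matrix m n ℂ}
    (hA : ‖A‖ ≤ 1) (hB : ‖B‖ ≤ 1) : ‖Matrix.fromBlocks A 0 0 B‖ ≤ 1 := by
  let φ : Matrix b b ℂ × Matrix n n ℂ →⋆ₙₐ[ℂ] Matrix (b ⊕ n) (b ⊕ n) ℂ :=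
    { toFun := fun X => Matrix.fromBlocks X.1 0 0 X.2
      map_smul' := fun c X => by simp [Matrix.fromBlocks_smul]
      map_zero' := by simp
      map_add' := fun X Y => by simp [Matrix.fromBlocks_add]
      map_mul' := fun X Y => by simp [Matrix.fromBlocks_multiply]
      map_star' := fun X => by
        simp [Matrix.star_eq_conjTranspose, Matrix.fromBlocks_conjTranspose] }
  rw [norm_matrix_le_one_iff] at hA hB ⊢
  have h : (Matrix.fromBlocks A 0 0 B)ᴴ * Matrix.fromBlocks A 0 0 B = φ (Aᴴ * A, Bᴴ * B) := by
    simp [φ, Matrix.fromBlocks_conjTranspose, Matrix.fromBlocks_multiply]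
  rw [h]
  exact (NonUnitalStarAlgHom.norm_apply_le φ _).trans (max_le hA hB)

omit [DecidableEq a] [DecidableEq b] in
theorem norm_fromRows_le_one {A₁ : Matrix a m ℂ} {A₂ : Matrix b m ℂ}
    (h : ‖A₁ᴴ * A₁ + A₂ᴴ * A₂‖ ≤ 1) : ‖Matrix.fromRows A₁ A₂‖ ≤ 1 := by
  rwa [norm_matrix_le_one_iff, Matrix.conjTranspose_fromRows_eq_fromCols_conjTranspose,
    Matrix.fromCols_mul_fromRows]

theorem norm_conjTranspose_mul_mul_add_le_one {A₁ A₂ : Matrix a m ℂ} {B₁ B₂ : Matrix a b ℂ}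
    {C₁ C₂ : Matrix b n ℂ} (hA : ‖A₁ᴴ * A₁ + A₂ᴴ * A₂‖ ≤ 1) (hC : ‖C₁ᴴ * C₁ + C₂ᴴ * C₂‖ ≤ 1)
    (hB₁ : ‖B₁‖ ≤ 1) (hB₂ : ‖B₂‖ ≤ 1) : ‖A₁ᴴ * B₁ * C₁ + A₂ᴴ * B₂ * C₂‖ ≤ 1 := by
  have h : A₁ᴴ * B₁ * C₁ + A₂ᴴ * B₂ * C₂ =
      (Matrix.fromRows A₁ A₂)ᴴ * (Matrix.fromBlocks B₁ 0 0 B₂ * Matrix.fromRows C₁ C₂) := by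
    rw [Matrix.conjTranspose_fromRows_eq_fromCols_conjTranspose, Matrix.fromBlocks_mul_fromRows,
      Matrix.fromCols_mul_fromRows]
    simp [Matrix.mul_assoc]
  rw [h]
  exact norm_matrix_mul_le_one (norm_conjTranspose_le_one (norm_fromRows_le_one hA))
    (norm_matrix_mul_le_one (norm_fromBlocks_diagonal_le_one hB₁ hB₂) (norm_fromRows_le_one hC))

theorem norm_eigenvectorUnitary_le_one {A : Matrix n n ℂ} (hA : A.IsHermitian) :
    ‖(hA.eigenvectorUnitary : Matrix n n ℂ)‖ ≤ 1 := by
  have h : (hA.eigenvectorUnitary : Matrix n n ℂ)ᴴ * (hA.eigenvectorUnitary : Matrix n n ℂ) = 1 :=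
    Matrix.mem_unitaryGroup_iff'.1 hA.eigenvectorUnitary.2
  rw [norm_matrix_le_one_iff, h, ← Matrix.diagonal_one]
  exact norm_diagonal_le_one (by simp)

theorem norm_trace_kronecker_mul_le {E : Matrix d d ℂ} (hE : E.PosSemidef) {L R : Matrix d d ℂ}
    {U : Matrix m n ℂ} {W : Matrix n n ℂ} {Y : Matrix (d × n) (d × m) ℂ} (hL : ‖L‖ ≤ 1)
    (hR : ‖R‖ ≤ 1) (hU : ‖U‖ ≤ 1) (hW : ‖W‖ ≤ 1) (hY : ‖Y‖ ≤ 1) (c : n → ℂ) :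
    ‖(((L * E * R) ⊗ₖ (U * Matrix.diagonal c * W)) * Y).trace‖ ≤ E.trace.re * ∑ j, ‖c j‖ := by
  set O : Matrix d d ℂ := (hE.1.eigenvectorUnitary : Matrix d d ℂ) with hO
  have hOn : ‖O‖ ≤ 1 := norm_eigenvectorUnitary_le_one hE.1
  have hsp : E = O * Matrix.diagonal (fun i => ((hE.1.eigenvalues i : ℝ) : ℂ)) * Oᴴ := by
    have := hE.1.spectral_theorem
    rw [Unitary.conjStarAlgAut_apply] at this
    exact this
  have htr : E.trace.re = ∑ i, hE.1.eigenvalues i := by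
    rw [hE.1.trace_eq_sum_eigenvalues]
    simp
  have hfac : (L * E * R) ⊗ₖ (U * Matrix.diagonal c * W) =
      ((L * O) ⊗ₖ U) * Matrix.diagonal (fun x : d × n => ((hE.1.eigenvalues x.1 : ℝ) : ℂ) * c x.2) *
        ((Oᴴ * R) ⊗ₖ W) := by
    rw [← Matrix.diagonal_kronecker_diagonal (fun i => ((hE.1.eigenvalues i : ℝ) : ℂ)) c,
      ← Matrix.mul_kronecker_mul,
      ← Matrix.mul_kronecker_mul]
    congr 1
    conv_lhs => rw [hsp]
    simp only [Matrix.mul_assoc]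
  rw [hfac, Matrix.mul_assoc, Matrix.mul_assoc, Matrix.trace_mul_comm, Matrix.mul_assoc]
  refine (norm_trace_diagonal_mul_le _ _ ?_).trans (le_of_eq ?_)
  · exact norm_matrix_mul_le_one (norm_matrix_mul_le_one (norm_kronecker_le_one
      (norm_matrix_mul_le_one (norm_conjTranspose_le_one hOn) hR) hW) hY)
      (norm_kronecker_le_one (norm_matrix_mul_le_one hL hOn) hU)
  · rw [htr, Finset.sum_mul_sum, Fintype.sum_prod_type]
    refine Finset.sum_congr rfl fun i _ => Finset.sum_congr rfl fun j _ => ?_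
    rw [norm_mul, Complex.norm_real, Real.norm_of_nonneg (hE.eigenvalues_nonneg i)]

end

section

variable {d e m n : Type*} [Fintype d] [Fintype e] [Fintype m] [Fintype n]
  [DecidableEq d] [DecidableEq e] [DecidableEq m] [DecidableEq n]

/-- The analytic family interpolating `(V D Wᴴ W D Vᴴ) ⊗ (U diag(σ) X)` with `D = diag(κ)`. -/
noncomputable def interpolant (p : ℝ) (V : Matrix d d ℂ) (κ : d → ℝ) (W : Matrix e d ℂ)
    (U : Matrix m n ℂ) (σ : n → ℝ) (X : Matrix n n ℂ) (z : ℂ) : Matrix (d × m) (d × n) ℂ :=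
  (V * Matrix.diagonal (fun a => zeroCpow (κ a) (p * z)) * (Wᴴ * W) *
      (Matrix.diagonal (fun a => zeroCpow (κ a) (p * z)) * Vᴴ)) ⊗ₖ
    (U * Matrix.diagonal (fun j => zeroCpow (σ j) (p * z)) * X)

omit [Fintype m] [DecidableEq e] [DecidableEq m] in
theorem matrixBoundedEntire_interpolant (p : ℝ) (V : Matrix d d ℂ) (κ : d → ℝ) (W : Matrix e d ℂ)
    (U : Matrix m n ℂ) (σ : n → ℝ) (X : Matrix n n ℂ) :
    MatrixBoundedEntire (interpolant p V κ W U σ X) := by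
  have hκ : MatrixBoundedEntire fun z => Matrix.diagonal (fun a => zeroCpow (κ a) (p * z)) :=
    .diagonal fun a => boundedEntire_zeroCpow_mul (κ a) p
  have hσ : MatrixBoundedEntire fun z => Matrix.diagonal (fun j => zeroCpow (σ j) (p * z)) :=
    .diagonal fun j => boundedEntire_zeroCpow_mul (σ j) p
  exact ((((MatrixBoundedEntire.const V).mul hκ).mul (.const _)).mul (hκ.mul (.const _))).kronecker
    (((MatrixBoundedEntire.const U).mul hσ).mul (.const X))

theorem norm_zeroCpow_le_one {a : ℝ} (ha : 0 ≤ a) {w : ℂ} (hw : w.re = 0) :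
    ‖zeroCpow a w‖ ≤ 1 := by
  simpa [hw] using norm_zeroCpow_le ha w

theorem norm_interpolant_add_le_one {p : ℝ} {V : Matrix d d ℂ} (hV : ‖V‖ ≤ 1) {κ : d → ℝ}
    (hκ : ∀ a, 0 ≤ κ a) {W₁ W₂ : Matrix e d ℂ} (hW : ‖W₁ᴴ * W₁ + W₂ᴴ * W₂‖ ≤ 1)
    {U₁ U₂ : Matrix m n ℂ} (hU₁ : ‖U₁‖ ≤ 1) (hU₂ : ‖U₂‖ ≤ 1)
    {X₁ X₂ : Matrix n n ℂ} (hX₁ : ‖X₁‖ ≤ 1) (hX₂ : ‖X₂‖ ≤ 1) {σ₁ σ₂ : n → ℝ}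
    (hσ₁ : ∀ j, 0 ≤ σ₁ j) (hσ₂ : ∀ j, 0 ≤ σ₂ j) {z : ℂ} (hz : z.re = 0) :
    ‖interpolant p V κ W₁ U₁ σ₁ X₁ z + interpolant p V κ W₂ U₂ σ₂ X₂ z‖ ≤ 1 := by
  have hpz : ((p : ℂ) * z).re = 0 := by simp [hz]
  set D : Matrix d d ℂ := Matrix.diagonal (fun a => zeroCpow (κ a) (p * z)) with hD
  have hDn : ‖D‖ ≤ 1 := norm_diagonal_le_one fun a => norm_zeroCpow_le_one (hκ a) hpz
  set B₁ : Matrix m n ℂ := U₁ * Matrix.diagonal (fun j => zeroCpow (σ₁ j) (p * z)) * X₁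
  set B₂ : Matrix m n ℂ := U₂ * Matrix.diagonal (fun j => zeroCpow (σ₂ j) (p * z)) * X₂
  have hB₁ : ‖B₁‖ ≤ 1 := norm_matrix_mul_le_one (norm_matrix_mul_le_one hU₁
    (norm_diagonal_le_one fun a => norm_zeroCpow_le_one (hσ₁ a) hpz)) hX₁
  have hB₂ : ‖B₂‖ ≤ 1 := norm_matrix_mul_le_one (norm_matrix_mul_le_one hU₂
    (norm_diagonal_le_one fun a => norm_zeroCpow_le_one (hσ₂ a) hpz)) hX₂
  have h1e : ‖(1 : Matrix e e ℂ)‖ ≤ 1 := by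
    rw [← Matrix.diagonal_one]; exact norm_diagonal_le_one (by simp)
  have h1m : ‖(1 : Matrix m m ℂ)‖ ≤ 1 := by
    rw [← Matrix.diagonal_one]; exact norm_diagonal_le_one (by simp)
  have h1n : ‖(1 : Matrix n n ℂ)‖ ≤ 1 := by
    rw [← Matrix.diagonal_one]; exact norm_diagonal_le_one (by simp)
  have key : interpolant p V κ W₁ U₁ σ₁ X₁ z + interpolant p V κ W₂ U₂ σ₂ X₂ z =
      ((V * D) ⊗ₖ (1 : Matrix m m ℂ)) *
        ((W₁ ⊗ₖ (1 : Matrix m m ℂ))ᴴ * ((1 : Matrix e e ℂ) ⊗ₖ B₁) * (W₁ ⊗ₖ (1 : Matrix n n ℂ)) +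
          (W₂ ⊗ₖ (1 : Matrix m m ℂ))ᴴ * ((1 : Matrix e e ℂ) ⊗ₖ B₂) * (W₂ ⊗ₖ (1 : Matrix n n ℂ))) *
        ((D * Vᴴ) ⊗ₖ (1 : Matrix n n ℂ)) := by
    simp only [Matrix.conjTranspose_kronecker, Matrix.conjTranspose_one,
      ← Matrix.mul_kronecker_mul, Matrix.mul_add, Matrix.add_mul, Matrix.mul_one, Matrix.one_mul]
    rfl
  rw [key]
  refine norm_matrix_mul_le_one (norm_matrix_mul_le_one (norm_kronecker_le_one
    (norm_matrix_mul_le_one hV hDn) h1m) ?_)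
    (norm_kronecker_le_one (norm_matrix_mul_le_one hDn (norm_conjTranspose_le_one hV)) h1n)
  refine norm_conjTranspose_mul_mul_add_le_one ?_ ?_ (norm_kronecker_le_one h1e hB₁)
    (norm_kronecker_le_one h1e hB₂)
  · simp only [Matrix.conjTranspose_kronecker, Matrix.conjTranspose_one,
      ← Matrix.mul_kronecker_mul, Matrix.one_mul, ← Matrix.add_kronecker]
    exact norm_kronecker_le_one hW h1m
  · simp only [Matrix.conjTranspose_kronecker, Matrix.conjTranspose_one,
      ← Matrix.mul_kronecker_mul, Matrix.one_mul, ← Matrix.add_kronecker]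
    exact norm_kronecker_le_one hW h1n

omit [DecidableEq e] in
theorem norm_trace_interpolant_mul_le {p : ℝ} (hp : 1 ≤ p) {V : Matrix d d ℂ} (hV : ‖V‖ ≤ 1)
    {κ : d → ℝ} (hκ : ∀ a, 0 ≤ κ a) (W : Matrix e d ℂ) {U : Matrix m n ℂ} (hU : ‖U‖ ≤ 1)
    {X : Matrix n n ℂ} (hX : ‖X‖ ≤ 1) {σ : n → ℝ} (hσ : ∀ j, 0 ≤ σ j) (hσ1 : ∑ j, σ j ^ p ≤ 1)
    {z : ℂ} (hz : z.re = 1) {Y : Matrix (d × n) (d × m) ℂ} (hY : ‖Y‖ ≤ 1) :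
    ‖(interpolant p V κ W U σ X z * Y).trace‖ ≤
      (Matrix.diagonal (fun a => ((κ a ^ (2 * p) : ℝ) : ℂ)) * (Wᴴ * W)).trace.re := by
  have hp0 : p ≠ 0 := by linarith
  set T : Matrix d d ℂ := Matrix.diagonal (fun a => zeroCpow (κ a) (p * (z - 1))) with hT
  have hTn : ‖T‖ ≤ 1 :=
    norm_diagonal_le_one fun a => norm_zeroCpow_le_one (hκ a) (by simp [hz])
  set D : Matrix d d ℂ := Matrix.diagonal (fun a => ((κ a ^ p : ℝ) : ℂ)) with hD
  have hDH : Dᴴ = D := by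
    rw [hD, Matrix.diagonal_conjTranspose]
    congr 1
    ext i
    simp
  have hfac (a : d) : zeroCpow (κ a) (p * z) =
      zeroCpow (κ a) (p * (z - 1)) * ((κ a ^ p : ℝ) : ℂ) := by
    rw [← zeroCpow_ofReal (hκ a) hp0, ← zeroCpow_add]
    congr 1
    ring
  have hTD : Matrix.diagonal (fun a => zeroCpow (κ a) (p * z)) = T * D := by
    rw [hT, hD, Matrix.diagonal_mul_diagonal]
    exact congrArg _ (funext hfac)
  have hDT : T * D = D * T := by
    rw [hT, hD, Matrix.diagonal_mul_diagonal, Matrix.diagonal_mul_diagonal]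
    exact congrArg _ (funext fun a => mul_comm _ _)
  have hE : (D * (Wᴴ * W) * D).PosSemidef := by
    have := Matrix.posSemidef_conjTranspose_mul_self (W * D)
    rwa [Matrix.conjTranspose_mul, hDH, Matrix.mul_assoc, ← Matrix.mul_assoc Wᴴ,
      ← Matrix.mul_assoc D] at this
  have htr : (D * (Wᴴ * W) * D).trace =
      (Matrix.diagonal (fun a => ((κ a ^ (2 * p) : ℝ) : ℂ)) * (Wᴴ * W)).trace := by
    rw [Matrix.trace_mul_comm, ← Matrix.mul_assoc, hD, Matrix.diagonal_mul_diagonal]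
    congr 3
    ext a
    rw [two_mul, Real.rpow_add_of_nonneg (hκ a) (by linarith) (by linarith)]
    push_cast
    rfl
  have hinterp : interpolant p V κ W U σ X z =
      (V * T * (D * (Wᴴ * W) * D) * (T * Vᴴ)) ⊗ₖ
        (U * Matrix.diagonal (fun j => zeroCpow (σ j) (p * z)) * X) := by
    unfold interpolant
    congr 1
    rw [hTD]
    conv_lhs => rw [Matrix.mul_assoc, hDT, ← hDT]
    nth_rewrite 2 [hDT]
    simp only [Matrix.mul_assoc]
  rw [hinterp, ← htr]
  refine (norm_trace_kronecker_mul_le hE (norm_matrix_mul_le_one hV hTn)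
    (norm_matrix_mul_le_one hTn (norm_conjTranspose_le_one hV)) hU hX hY _).trans ?_
  have h0 : 0 ≤ (D * (Wᴴ * W) * D).trace.re := (Complex.nonneg_iff.1 hE.trace_nonneg).1
  refine mul_le_of_le_one_right h0 (le_trans (Finset.sum_le_sum fun j _ => ?_) hσ1)
  simpa [hz] using norm_zeroCpow_le (hσ j) (p * z)

theorem sum_rpow_le_of_interpolant {p : ℝ} (hp : 1 ≤ p) {V : Matrix d d ℂ} (hV : ‖V‖ ≤ 1)
    {κ : d → ℝ} (hκ : ∀ a, 0 ≤ κ a) {W₁ W₂ : Matrix e d ℂ} (hW : ‖W₁ᴴ * W₁ + W₂ᴴ * W₂‖ ≤ 1)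
    {U₁ U₂ : Matrix m n ℂ} (hU₁ : ‖U₁‖ ≤ 1) (hU₂ : ‖U₂‖ ≤ 1)
    {X₁ X₂ : Matrix n n ℂ} (hX₁ : ‖X₁‖ ≤ 1) (hX₂ : ‖X₂‖ ≤ 1) {σ₁ σ₂ : n → ℝ}
    (hσ₁ : ∀ j, 0 ≤ σ₁ j) (hσ₂ : ∀ j, 0 ≤ σ₂ j)
    (hs₁ : ∑ j, σ₁ j ^ p ≤ 1) (hs₂ : ∑ j, σ₂ j ^ p ≤ 1)
    {L : Matrix (d × m) (d × n) ℂ} {R : Matrix (d × n) (d × n) ℂ} (hL : ‖L‖ ≤ 1) (hR : ‖R‖ ≤ 1)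
    {s : d × n → ℝ} (hs : ∀ k, 0 ≤ s k)
    (hLR : Lᴴ * (interpolant p V κ W₁ U₁ σ₁ X₁ (p⁻¹ : ℝ) +
      interpolant p V κ W₂ U₂ σ₂ X₂ (p⁻¹ : ℝ)) * R = Matrix.diagonal (fun k => (s k : ℂ))) :
    ∑ k, s k ^ p ≤ (∑ k, s k ^ p) ^ (1 - p⁻¹) * (∑ a, κ a ^ (2 * p)) ^ p⁻¹ := by
  have hp0 : 0 < p := by linarith
  set F : ℂ → Matrix (d × m) (d × n) ℂ := fun z =>
    interpolant p V κ W₁ U₁ σ₁ X₁ z + interpolant p V κ W₂ U₂ σ₂ X₂ z with hF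
  set C : ℂ → Matrix (d × n) (d × n) ℂ := fun z =>
    Matrix.diagonal (fun k => zeroCpow (s k) ((-p : ℝ) * z + p)) with hC
  have hG : BoundedEntire fun z => (F z * (R * C z * Lᴴ)).trace := by
    refine MatrixBoundedEntire.trace (.mul (.add
      (matrixBoundedEntire_interpolant p V κ W₁ U₁ σ₁ X₁)
      (matrixBoundedEntire_interpolant p V κ W₂ U₂ σ₂ X₂))
      (.mul (.mul (.const _) (.diagonal fun k => ?_))
        (.const _)))
    exact boundedEntire_zeroCpow (s k) (-p) p
  have hcyc (z : ℂ) : (F z * (R * C z * Lᴴ)).trace = (C z * (Lᴴ * F z * R)).trace := by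
    rw [Matrix.trace_mul_comm (C z), ← Matrix.mul_assoc, Matrix.trace_mul_comm]
    simp only [Matrix.mul_assoc]
  have h0 : ∀ z : ℂ, z.re = 0 → ‖(F z * (R * C z * Lᴴ)).trace‖ ≤ ∑ k, s k ^ p := by
    intro z hz
    rw [hcyc]
    refine (norm_trace_diagonal_mul_le _ _ (norm_matrix_mul_le_one (norm_matrix_mul_le_one
      (norm_conjTranspose_le_one hL)
      (norm_interpolant_add_le_one hV hκ hW hU₁ hU₂ hX₁ hX₂ hσ₁ hσ₂ hz)) hR)).trans
      (Finset.sum_le_sum fun k _ => ?_)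
    simpa [hz] using norm_zeroCpow_le (hs k) ((-p : ℝ) * z + p)
  have h1 : ∀ z : ℂ, z.re = 1 → ‖(F z * (R * C z * Lᴴ)).trace‖ ≤ ∑ a, κ a ^ (2 * p) := by
    intro z hz
    have hY : ‖R * C z * Lᴴ‖ ≤ 1 := norm_matrix_mul_le_one (norm_matrix_mul_le_one hR
      (norm_diagonal_le_one fun k => norm_zeroCpow_le_one (hs k) (by simp [hz])))
      (norm_conjTranspose_le_one hL)
    rw [hF, Matrix.add_mul, Matrix.trace_add]
    refine (norm_add_le _ _).trans ((add_le_add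
      (norm_trace_interpolant_mul_le hp hV hκ W₁ hU₁ hX₁ hσ₁ hs₁ hz hY)
      (norm_trace_interpolant_mul_le hp hV hκ W₂ hU₂ hX₂ hσ₂ hs₂ hz hY)).trans ?_)
    rw [← Complex.add_re, ← Matrix.trace_add, ← Matrix.mul_add]
    refine (Complex.re_le_norm _).trans ((norm_trace_diagonal_mul_le _ _ hW).trans (le_of_eq ?_))
    refine Finset.sum_congr rfl fun a _ => ?_
    rw [Complex.norm_real, Real.norm_of_nonneg (Real.rpow_nonneg (hκ a) _)]
  have h := hG.norm_le_interp h0 h1 (inv_nonneg.2 hp0.le) (inv_le_one_of_one_le₀ hp)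
  refine le_trans (le_of_eq ?_) h
  have hval : (F (p⁻¹ : ℝ) * (R * C (p⁻¹ : ℝ) * Lᴴ)).trace = ((∑ k, s k ^ p : ℝ) : ℂ) := by
    rw [hcyc, hF, hLR, hC, Matrix.diagonal_mul_diagonal, Matrix.trace_diagonal]
    push_cast
    refine Finset.sum_congr rfl fun k _ => ?_
    have h1 : (s k : ℂ) = zeroCpow (s k) 1 := by
      simpa using (zeroCpow_ofReal (hs k) one_ne_zero).symm
    have h2 : ((s k ^ p : ℝ) : ℂ) = zeroCpow (s k) p := (zeroCpow_ofReal (hs k) hp0.ne').symm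
    rw [h2, h1, ← zeroCpow_add]
    congr 1
    have : (p : ℂ) ≠ 0 := by exact_mod_cast hp0.ne'
    field_simp
    ring
  rw [hval, Complex.norm_real, Real.norm_of_nonneg]
  exact Finset.sum_nonneg fun k _ => Real.rpow_nonneg (hs k) _

end

section

variable {d e m n : Type*} [Fintype d] [Fintype e] [Fintype m] [Fintype n]
  [DecidableEq d] [DecidableEq e] [DecidableEq m] [DecidableEq n]

omit [Fintype m] [DecidableEq e] [DecidableEq m] in
theorem interpolant_inv {p : ℝ} (hp : p ≠ 0) (V : Matrix d d ℂ) {κ : d → ℝ} (hκ : ∀ a, 0 ≤ κ a)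
    (W : Matrix e d ℂ) (U : Matrix m n ℂ) {σ : n → ℝ} (hσ : ∀ j, 0 ≤ σ j) (X : Matrix n n ℂ) :
    interpolant p V κ W U σ X (p⁻¹ : ℝ) =
      (V * Matrix.diagonal (fun a => (κ a : ℂ)) * (Wᴴ * W) *
          (Matrix.diagonal (fun a => (κ a : ℂ)) * Vᴴ)) ⊗ₖ
        (U * Matrix.diagonal (fun j => (σ j : ℂ)) * X) := by
  have h1 {a : ℝ} (ha : 0 ≤ a) : zeroCpow a (p * (p⁻¹ : ℝ)) = a := by
    rw [← Complex.ofReal_mul, mul_inv_cancel₀ hp, zeroCpow_ofReal ha one_ne_zero, Real.rpow_one]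
  simp only [interpolant, h1 (hκ _), h1 (hσ _)]

theorem rpow_inv_le_of_le_rpow_mul_rpow {N T p : ℝ} (hp : 0 < p) (hN : 0 ≤ N) (hT : 0 ≤ T)
    (h : N ≤ N ^ (1 - p⁻¹) * T ^ p⁻¹) : N ^ (1 / p) ≤ T ^ (1 / p) := by
  rw [one_div]
  rcases hN.eq_or_lt with rfl | hN
  · rw [Real.zero_rpow (inv_ne_zero hp.ne')]
    exact Real.rpow_nonneg hT _
  · refine le_of_mul_le_mul_left (a := N ^ (1 - p⁻¹)) ?_ (Real.rpow_pos_of_pos hN _)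
    rwa [← Real.rpow_add hN, sub_add_cancel, Real.rpow_one]

omit [DecidableEq m] in
theorem schattenNorm_eq_sum_sqrt (q : ℝ) (A : Matrix m n ℂ) :
    schattenNorm q A =
      (∑ i, √((Matrix.posSemidef_conjTranspose_mul_self A).1.eigenvalues i) ^ q) ^ (1 / q) := by
  unfold schattenNorm
  congr 1
  refine Finset.sum_congr rfl fun i _ => ?_
  rw [Real.sqrt_eq_rpow, ← Real.rpow_mul
    ((Matrix.posSemidef_conjTranspose_mul_self A).eigenvalues_nonneg i)]
  congr 1
  ring

/-- If positive semidefinite `P₁, P₂` are tensored with matrices of Schatten norm at most one,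
the Schatten norm of the sum is at most that of `P₁ + P₂`. -/
theorem schattenNorm_kronecker_add_le {p : ℝ} (hp : 1 ≤ p) {P₁ P₂ : Matrix d d ℂ}
    (hP₁ : P₁.PosSemidef) (hP₂ : P₂.PosSemidef)
    {U₁ U₂ : Matrix m n ℂ} (hU₁ : ‖U₁‖ ≤ 1) (hU₂ : ‖U₂‖ ≤ 1)
    {X₁ X₂ : Matrix n n ℂ} (hX₁ : ‖X₁‖ ≤ 1) (hX₂ : ‖X₂‖ ≤ 1) {σ₁ σ₂ : n → ℝ}
    (hσ₁ : ∀ j, 0 ≤ σ₁ j) (hσ₂ : ∀ j, 0 ≤ σ₂ j)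
    (hs₁ : ∑ j, σ₁ j ^ p ≤ 1) (hs₂ : ∑ j, σ₂ j ^ p ≤ 1) :
    schattenNorm p (P₁ ⊗ₖ (U₁ * Matrix.diagonal (fun j => (σ₁ j : ℂ)) * X₁) +
        P₂ ⊗ₖ (U₂ * Matrix.diagonal (fun j => (σ₂ j : ℂ)) * X₂)) ≤
      schattenNorm p (P₁ + P₂) := by
  have hp0 : 0 < p := by linarith
  obtain ⟨Q₁, hQ₁⟩ : ∃ Q : Matrix d d ℂ, P₁ = Qᴴ * Q := by
    open scoped MatrixOrder in
    exact CStarAlgebra.nonneg_iff_eq_star_mul_self.mp hP₁.nonneg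
  obtain ⟨Q₂, hQ₂⟩ : ∃ Q : Matrix d d ℂ, P₂ = Qᴴ * Q := by
    open scoped MatrixOrder in
    exact CStarAlgebra.nonneg_iff_eq_star_mul_self.mp hP₂.nonneg
  set K : Matrix (d ⊕ d) d ℂ := Matrix.fromRows Q₁ Q₂ with hK
  have hKK : P₁ + P₂ = Kᴴ * K := by
    rw [hK, Matrix.conjTranspose_fromRows_eq_fromCols_conjTranspose,
      Matrix.fromCols_mul_fromRows, hQ₁, hQ₂]
  set hKe := Matrix.posSemidef_conjTranspose_mul_self K
  obtain ⟨U, V, hU, hV, hUV, -⟩ := exists_svd K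
  set κ : d → ℝ := fun a => √(hKe.1.eigenvalues a) with hκdef
  have hκ : ∀ a, 0 ≤ κ a := fun a => Real.sqrt_nonneg _
  set D : Matrix d d ℂ := Matrix.diagonal fun a => (κ a : ℂ) with hD
  have hDH : Dᴴ = D := by
    rw [hD, Matrix.diagonal_conjTranspose]
    congr 1
    ext i
    simp
  have hUrows : ‖U.toRows₁ᴴ * U.toRows₁ + U.toRows₂ᴴ * U.toRows₂‖ ≤ 1 := by
    rw [← Matrix.fromCols_mul_fromRows, ← Matrix.conjTranspose_fromRows_eq_fromCols_conjTranspose,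
      Matrix.fromRows_toRows]
    exact norm_matrix_le_one_iff.1 hU
  have hrows : Matrix.fromRows Q₁ Q₂ =
      Matrix.fromRows (U.toRows₁ * D * Vᴴ) (U.toRows₂ * D * Vᴴ) := by
    rw [← Matrix.fromRows_mul, ← Matrix.fromRows_mul, Matrix.fromRows_toRows]
    exact hUV
  have hW₁ : Q₁ = U.toRows₁ * D * Vᴴ := congrArg Matrix.toRows₁ hrows
  have hW₂ : Q₂ = U.toRows₂ * D * Vᴴ := congrArg Matrix.toRows₂ hrows
  have hP₁' : P₁ = V * D * (U.toRows₁ᴴ * U.toRows₁) * (D * Vᴴ) := by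
    rw [hQ₁, hW₁]
    simp only [Matrix.conjTranspose_mul, Matrix.conjTranspose_conjTranspose, hDH, Matrix.mul_assoc]
  have hP₂' : P₂ = V * D * (U.toRows₂ᴴ * U.toRows₂) * (D * Vᴴ) := by
    rw [hQ₂, hW₂]
    simp only [Matrix.conjTranspose_mul, Matrix.conjTranspose_conjTranspose, hDH, Matrix.mul_assoc]
  set A := P₁ ⊗ₖ (U₁ * Matrix.diagonal (fun j => (σ₁ j : ℂ)) * X₁) +
        P₂ ⊗ₖ (U₂ * Matrix.diagonal (fun j => (σ₂ j : ℂ)) * X₂) with hA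
  have hAint : interpolant p V κ U.toRows₁ U₁ σ₁ X₁ (p⁻¹ : ℝ) +
      interpolant p V κ U.toRows₂ U₂ σ₂ X₂ (p⁻¹ : ℝ) = A := by
    rw [interpolant_inv hp0.ne' V hκ _ _ hσ₁, interpolant_inv hp0.ne' V hκ _ _ hσ₂, ← hD,
      ← hP₁', ← hP₂']
  obtain ⟨L, R, hL, hR, -, hLR⟩ := exists_svd A
  rw [← hAint] at hLR
  have h := sum_rpow_le_of_interpolant hp hV hκ hUrows hU₁ hU₂ hX₁ hX₂ hσ₁ hσ₂ hs₁ hs₂ hL hR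
    (fun k => Real.sqrt_nonneg _) hLR
  rw [hAint] at h
  have hκp : ∑ a, κ a ^ (2 * p) = ∑ a, hKe.1.eigenvalues a ^ p := by
    refine Finset.sum_congr rfl fun a _ => ?_
    rw [Real.rpow_mul (hκ a), Real.rpow_two, hκdef, Real.sq_sqrt (hKe.eigenvalues_nonneg a)]
  rw [hκp] at h
  rw [hKK, schattenNorm_conjTranspose_mul_self, schattenNorm_eq_sum_sqrt]
  exact rpow_inv_le_of_le_rpow_mul_rpow hp0
    (Finset.sum_nonneg fun k _ => Real.rpow_nonneg (Real.sqrt_nonneg _) _)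
    (Finset.sum_nonneg fun a _ => Real.rpow_nonneg (hKe.eigenvalues_nonneg a) _) h

omit [DecidableEq m] in
theorem schattenNorm_nonneg (q : ℝ) (A : Matrix m n ℂ) : 0 ≤ schattenNorm q A :=
  Real.rpow_nonneg (Finset.sum_nonneg fun i _ => Real.rpow_nonneg
    ((Matrix.posSemidef_conjTranspose_mul_self A).eigenvalues_nonneg i) _) _

omit [DecidableEq m] in
theorem exists_normalized_svd {p : ℝ} (hp : 0 < p) (A : Matrix m n ℂ) :
    ∃ (U : Matrix m n ℂ) (X : Matrix n n ℂ) (σ : n → ℝ), ‖U‖ ≤ 1 ∧ ‖X‖ ≤ 1 ∧ (∀ j, 0 ≤ σ j) ∧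
      ∑ j, σ j ^ p ≤ 1 ∧
      A = (schattenNorm p A : ℂ) • (U * Matrix.diagonal (fun j => (σ j : ℂ)) * X) := by
  obtain ⟨U, V, hU, hV, hA, -⟩ := exists_svd A
  set s : n → ℝ := fun i => √((Matrix.posSemidef_conjTranspose_mul_self A).1.eigenvalues i) with hs
  have hs0 : ∀ j, 0 ≤ s j := fun j => Real.sqrt_nonneg _
  have hx0 := schattenNorm_nonneg p A
  have hsum0 : 0 ≤ ∑ j, s j ^ p := Finset.sum_nonneg fun j _ => Real.rpow_nonneg (hs0 j) _
  have hxp : schattenNorm p A ^ p = ∑ j, s j ^ p := by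
    rw [schattenNorm_eq_sum_sqrt, ← Real.rpow_mul hsum0, one_div, inv_mul_cancel₀ hp.ne',
      Real.rpow_one]
  set x := schattenNorm p A with hx
  have hcancel (j : n) : x * (s j / x) = s j := by
    rcases eq_or_ne x 0 with h | h
    · rw [h, Real.zero_rpow hp.ne', eq_comm,
        Finset.sum_eq_zero_iff_of_nonneg fun j _ => Real.rpow_nonneg (hs0 j) _] at hxp
      have := (Real.rpow_eq_zero (hs0 j) hp.ne').1 (hxp j (Finset.mem_univ j))
      simp [this]
    · field_simp
  refine ⟨U, Vᴴ, fun j => s j / x, hU, norm_conjTranspose_le_one hV,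
    fun j => div_nonneg (hs0 j) hx0, ?_, ?_⟩
  · simp only [Real.div_rpow (hs0 _) hx0]
    rw [← Finset.sum_div, hxp]
    exact div_self_le_one _
  · conv_lhs => rw [hA]
    rw [← Matrix.smul_mul, ← Matrix.mul_smul, ← Matrix.diagonal_smul]
    congr 3
    ext j
    rw [Pi.smul_apply, smul_eq_mul, ← Complex.ofReal_mul, hcancel]

theorem schattenNorm_le_of_norm_le {q C : ℝ} (hq : 0 < q) {A : Matrix m n ℂ} (hA : ‖A‖ ≤ C) :
    schattenNorm q A ≤ (∑ _i : n, C ^ q) ^ (1 / q) := by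
  obtain ⟨U, V, hU, hV, -, hUV⟩ := exists_svd A
  rw [schattenNorm_eq_sum_sqrt]
  refine Real.rpow_le_rpow
    (Finset.sum_nonneg fun k _ => Real.rpow_nonneg (Real.sqrt_nonneg _) _)
    (Finset.sum_le_sum fun i _ => Real.rpow_le_rpow (Real.sqrt_nonneg _) ?_ hq.le) (by positivity)
  have h1 : ‖Uᴴ * A * V‖ ≤ C := by
    refine (Matrix.l2_opNorm_mul _ _).trans ((mul_le_of_le_one_right (norm_nonneg _) hV).trans
      ((Matrix.l2_opNorm_mul _ _).trans
        ((mul_le_of_le_one_left (norm_nonneg _) (norm_conjTranspose_le_one hU)).trans hA)))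
  have h2 := (norm_matrix_apply_le _ i i).trans h1
  rwa [hUV, Matrix.diagonal_apply_eq, Complex.norm_real,
    Real.norm_of_nonneg (Real.sqrt_nonneg _)] at h2

end

/-- the square-rooted form of inequality (3) for maps whose Choi matrix
factors with blocks that are phases times PSD matrices: for PSD `H₁, H₂`, phases `φ₁, φ₂`,
arbitrary `X₁, X₂` and `p ≥ 1`,
`‖e^{iφ₁} H₁ ⊗ X₁ + e^{iφ₂} H₂ ⊗ X₂‖_p ≤ max_θ ‖‖X₁‖_p H₁ + e^{iθ} ‖X₂‖_p H₂‖_p`. -/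
theorem schatten_phasePSD_kronecker_le (d m m' : ℕ) (p : ℝ) (hp : 1 ≤ p)
    (H₁ H₂ : Matrix (Fin d) (Fin d) ℂ) (hH₁ : H₁.PosSemidef) (hH₂ : H₂.PosSemidef)
    (φ₁ φ₂ : ℝ) (X₁ X₂ : Matrix (Fin m) (Fin m') ℂ) :
    schattenNorm p
        (Complex.exp (φ₁ * Complex.I) • (H₁ ⊗ₖ X₁) + Complex.exp (φ₂ * Complex.I) • (H₂ ⊗ₖ X₂)) ≤
      ⨆ θ : Set.Ico (0 : ℝ) (2 * Real.pi),
        schattenNorm p ((schattenNorm p X₁ : ℂ) • H₁ + (Complex.exp ((θ : ℝ) * Complex.I) * (schattenNorm p X₂ : ℂ)) • H₂) := by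
  have hp0 : 0 < p := by linarith
  obtain ⟨U₁, V₁, σ₁, hU₁, hV₁, hσ₁, hs₁, hX₁⟩ := exists_normalized_svd hp0 X₁
  obtain ⟨U₂, V₂, σ₂, hU₂, hV₂, hσ₂, hs₂, hX₂⟩ := exists_normalized_svd hp0 X₂
  have hx₁ := schattenNorm_nonneg p X₁
  have hx₂ := schattenNorm_nonneg p X₂
  set x₁ := schattenNorm p X₁
  set x₂ := schattenNorm p X₂
  have hphase (φ : ℝ) {U : Matrix (Fin m) (Fin m') ℂ} (hU : ‖U‖ ≤ 1) :
      ‖Complex.exp (φ * Complex.I) • U‖ ≤ 1 := by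
    rwa [norm_smul, Complex.norm_exp_ofReal_mul_I, one_mul]
  have key := schattenNorm_kronecker_add_le hp
    (hH₁.smul (a := (x₁ : ℂ)) (by exact_mod_cast hx₁))
    (hH₂.smul (a := (x₂ : ℂ)) (by exact_mod_cast hx₂))
    (hphase φ₁ hU₁) (hphase φ₂ hU₂) hV₁ hV₂ hσ₁ hσ₂ hs₁ hs₂
  have hbdd : BddAbove (Set.range fun θ : Set.Ico (0 : ℝ) (2 * Real.pi) =>
      schattenNorm p ((x₁ : ℂ) • H₁ + (Complex.exp ((θ : ℝ) * Complex.I) * (x₂ : ℂ)) • H₂)) := by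
    refine ⟨_, Set.forall_mem_range.2 fun θ =>
      schattenNorm_le_of_norm_le (C := x₁ * ‖H₁‖ + x₂ * ‖H₂‖) hp0 ?_⟩
    refine (norm_add_le _ _).trans (le_of_eq ?_)
    rw [norm_smul, norm_smul, norm_mul, Complex.norm_exp_ofReal_mul_I, one_mul, Complex.norm_real,
      Complex.norm_real, Real.norm_of_nonneg hx₁, Real.norm_of_nonneg hx₂]
  refine le_trans (le_of_eq_of_le (congrArg _ ?_) (key.trans_eq (congrArg _ ?_)))
    (le_ciSup hbdd ⟨0, le_rfl, Real.two_pi_pos⟩)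
  · conv_lhs => rw [hX₁, hX₂]
    simp only [Matrix.smul_kronecker, Matrix.kronecker_smul, Matrix.smul_mul]
  · simp
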